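/- arXiv:math/0501076 — 5 statements merged into one kernel-verified Lean document; each statement's English description precedes it below -/
import Mathlib

section
/- If X is a compact Hausdorff topological space that is homogeneous and has countable tightness, then the cardinality of X is at most 2^ℵ₀ (the continuum). -/
open Cardinal Topology

section Omega1

variable {I : Type*} [LinearOrder I]

theorem exists_forall_eq_image_Iio [WellFoundedLT I] {D : Type*} (F : Set D → D) :
    ∃ f : I → D, ∀ i, f i = F (f '' Set.Iio i) := by
  let G : (i : I) → ((j : I) → j < i → D) → D := fun i g => F {d | ∃ j, ∃ h : j < i, g j h = d}
  refine ⟨(wellFounded_lt (α := I)).fix G, fun i => ?_⟩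
  rw [WellFounded.fix_eq]
  simp only [G]
  congr 1
  ext d
  simp

theorem exists_gt_of_countable [Uncountable I] (hI : ∀ i : I, (Set.Iio i).Countable)
    {s : Set I} (hs : s.Countable) : ∃ i, ∀ j ∈ s, j < i := by
  by_contra! h
  refine Set.not_countable_univ (α := I) ((hs.biUnion (t := fun j _ => Set.Iic j) ?_).mono ?_)
  · intro j _
    rw [← Set.Iio_insert]
    exact (hI j).insert j
  · intro i _
    obtain ⟨j, hj, hij⟩ := h i
    exact Set.mem_biUnion hj hij

theorem countable_Iio_toType_ord_aleph_one (i : (ℵ_ 1).ord.ToType) : (Set.Iio i).Countable := by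
  have h : #(Set.Iio i) < ℵ_ 1 := by
    simpa using Cardinal.mk_Iio_lt i (by simp)
  rw [← Cardinal.le_aleph0_iff_set_countable, ← Order.lt_succ_iff]
  exact h.trans_eq Cardinal.succ_aleph0.symm

theorem uncountable_toType_ord_aleph_one : Uncountable (ℵ_ 1).ord.ToType := by
  rw [← Cardinal.aleph0_lt_mk_iff, Cardinal.mk_ord_toType]
  exact Cardinal.aleph0_lt_aleph_one

end Omega1

section CountablyTight

variable {X : Type*} [TopologicalSpace X] [CompactSpace X]

/-- A countably tight compact space has no uncountable free sequence. -/
theorem exists_closure_Iio_inter_closure_Ici_nonempty {I : Type*} [LinearOrder I] [Uncountable I]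
    (hI : ∀ i : I, (Set.Iio i).Countable)
    (tight : ∀ (A : Set X) (x : X), x ∈ closure A → ∃ B ⊆ A, B.Countable ∧ x ∈ closure B)
    (x : I → X) : ∃ i, (closure (x '' Set.Iio i) ∩ closure (x '' Set.Ici i)).Nonempty := by
  have hne : (⋂ i, closure (x '' Set.Ici i)).Nonempty := by
    refine IsCompact.nonempty_iInter_of_directed_nonempty_isCompact_isClosed _ ?_ ?_
      (fun i => isClosed_closure.isCompact) (fun i => isClosed_closure)
    · intro i j
      exact ⟨max i j, closure_mono (Set.image_mono (Set.Ici_subset_Ici.2 (le_max_left i j))),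
        closure_mono (Set.image_mono (Set.Ici_subset_Ici.2 (le_max_right i j)))⟩
    · exact fun i => (Set.nonempty_Ici.image x).closure
  obtain ⟨q, hq⟩ := hne
  rw [Set.mem_iInter] at hq
  obtain ⟨i₀⟩ : Nonempty I := inferInstance
  obtain ⟨B, hB, hBc, hqB⟩ := tight _ _ (closure_mono (Set.image_subset_range _ _) (hq i₀))
  choose! g hg using fun b (hb : b ∈ B) => hB hb
  obtain ⟨i, hi⟩ := exists_gt_of_countable hI (hBc.image g)
  refine ⟨i, q, closure_mono (fun b hb => ?_) hqB, hq i⟩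
  exact ⟨g b, hi _ ⟨b, hb, rfl⟩, hg b hb⟩

variable [T2Space X]

/-- Every point of a countably tight compact Hausdorff space has a countable local `π`-base. -/
theorem exists_countable_local_pi_base
    (tight : ∀ (A : Set X) (x : X), x ∈ closure A → ∃ B ⊆ A, B.Countable ∧ x ∈ closure B)
    (p : X) : ∃ 𝒢 : Set (Set X), 𝒢.Countable ∧ (∀ G ∈ 𝒢, IsOpen G ∧ G.Nonempty) ∧
      ∀ U ∈ 𝓝 p, ∃ G ∈ 𝒢, G ⊆ U := by
  by_contra! hp
  let O : Set (Set X × Set X) → Set (Set X) := fun T =>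
    Prod.fst '' T ∪ (fun d => (closure d.2)ᶜ) '' T
  have step : ∀ T : Set (Set X × Set X), ∃ d : Set X × Set X, T.Countable →
      IsOpen d.1 ∧ IsOpen d.2 ∧ p ∈ d.1 ∧ closure d.1 ⊆ d.2 ∧
      ∀ s ⊆ O T, s.Finite → (∀ G ∈ s, IsOpen G) → (⋂₀ s).Nonempty →
        (⋂₀ s ∩ (closure d.2)ᶜ).Nonempty := by
    intro T
    by_cases hT : T.Countable
    swap
    · exact ⟨(∅, ∅), fun h => absurd h hT⟩
    have hO : (O T).Countable := (hT.image _).union (hT.image _)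
    obtain ⟨U, hU, hUG⟩ := hp
      {G | (IsOpen G ∧ G.Nonempty) ∧ G ∈ Set.sInter '' {s | s.Finite ∧ s ⊆ O T}}
      (((Set.countable_ofPred_finite_subset hO).image _).mono fun G hG => hG.2)
      (fun G hG => hG.1)
    obtain ⟨C, hC, hCc, hCU⟩ := exists_mem_nhds_isClosed_subset hU
    obtain ⟨E, hE, hEc, hEC⟩ := exists_mem_nhds_isClosed_subset (interior_mem_nhds.2 hC)
    refine ⟨(interior E, interior C), fun _ => ⟨isOpen_interior, isOpen_interior,
      mem_interior_iff_mem_nhds.2 hE, (closure_minimal interior_subset hEc).trans hEC, ?_⟩⟩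
    intro s hs hsf hso hne
    have := hUG (⋂₀ s) ⟨⟨hsf.isOpen_sInter hso, hne⟩, s, ⟨hsf, hs⟩, rfl⟩
    obtain ⟨z, hz, hzU⟩ := Set.not_subset.1 this
    exact ⟨z, hz, fun h => hzU (hCU (closure_minimal interior_subset hCc h))⟩
  choose F hF using step
  let I : Type := (ℵ_ 1).ord.ToType
  have : Uncountable I := uncountable_toType_ord_aleph_one
  have hI : ∀ i : I, (Set.Iio i).Countable := countable_Iio_toType_ord_aleph_one
  obtain ⟨f, hf⟩ := exists_forall_eq_image_Iio (I := I) F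
  have key := fun i => hF (f '' Set.Iio i) ((hI i).image f)
  simp only [← hf] at key
  classical
  let Q : I → I → Set X := fun a i => if i ≤ a then (f i).1 else (closure (f i).2)ᶜ
  have hQo : ∀ a i, IsOpen (Q a i) := by
    intro a i
    by_cases h : i ≤ a
    · simpa [Q, h] using (key i).1
    · simp [Q, h]
  have hQ : ∀ a (u : Finset I), (⋂ i ∈ u, Q a i).Nonempty := by
    intro a u
    induction u using Finset.induction_on_max with
    | empty => exact ⟨p, by simp⟩
    | insert m u hm ih =>
      by_cases h : m ≤ a
      · refine ⟨p, Set.mem_iInter₂.2 fun i hi => ?_⟩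
        have : i ≤ a := by
          rcases Finset.mem_insert.1 hi with rfl | hi
          · exact h
          · exact (hm i hi).le.trans h
        simpa [Q, this] using (key i).2.2.1
      · have hsub : Q a '' (u : Set I) ⊆ O (f '' Set.Iio m) := by
          rintro _ ⟨i, hi, rfl⟩
          by_cases hia : i ≤ a
          · exact Or.inl ⟨f i, ⟨i, hm i hi, rfl⟩, by simp [Q, hia]⟩
          · exact Or.inr ⟨f i, ⟨i, hm i hi, rfl⟩, by simp [Q, hia]⟩
        have := (key m).2.2.2.2 _ hsub (u.finite_toSet.image _)
          (by rintro _ ⟨i, _, rfl⟩; exact hQo a i) (by simpa [Set.sInter_image] using ih)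
        rw [Finset.set_biInter_insert, Set.inter_comm]
        simpa [Set.sInter_image, Q, h] using this
  have hx : ∀ a, ∃ x, ∀ i, x ∈ closure (Q a i) := by
    intro a
    have := CompactSpace.iInter_nonempty (t := fun i => closure (Q a i))
      (fun i => isClosed_closure) (fun u => (hQ a u).mono
        (Set.iInter₂_mono fun i _ => subset_closure))
    obtain ⟨x, hx⟩ := this
    exact ⟨x, Set.mem_iInter.1 hx⟩
  choose x hx using hx
  obtain ⟨i, z, hz₁, hz₂⟩ := exists_closure_Iio_inter_closure_Ici_nonempty hI tight x
  have h₁ : closure (x '' Set.Iio i) ⊆ ((f i).2)ᶜ := by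
    refine closure_minimal ?_ (key i).2.1.isClosed_compl
    rintro _ ⟨a, ha, rfl⟩
    have := hx a i
    simp only [Q, not_le.2 (Set.mem_Iio.1 ha), if_false] at this
    refine closure_minimal ?_ (key i).2.1.isClosed_compl this
    exact Set.compl_subset_compl.2 subset_closure
  have h₂ : closure (x '' Set.Ici i) ⊆ closure (f i).1 := by
    refine closure_minimal ?_ isClosed_closure
    rintro _ ⟨a, ha, rfl⟩
    have := hx a i
    simpa only [Q, Set.mem_Ici.1 ha, if_true] using this
  exact h₁ hz₁ ((key i).2.2.2.1 (h₂ hz₂))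

/-- A nonempty countably tight compact Hausdorff space has a nonempty closed `Gδ` subset contained
in the closure of a countable set. -/
theorem exists_isGδ_subset_closure_countable [Nonempty X]
    (tight : ∀ (A : Set X) (x : X), x ∈ closure A → ∃ B ⊆ A, B.Countable ∧ x ∈ closure B) :
    ∃ G S : Set X, IsGδ G ∧ G.Nonempty ∧ S.Countable ∧ G ⊆ closure S := by
  by_contra! h
  have step : ∀ T : Set (X × Set X), ∃ d : X × Set X, T.Countable →
      (∀ t ∈ T, IsGδ t.2 ∧ IsClosed t.2) →
      (IsGδ d.2 ∧ IsClosed d.2) ∧ ((⋂ t ∈ T, t.2).Nonempty → d.1 ∈ d.2 ∧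
        d.1 ∈ (⋂ t ∈ T, t.2) ∧ Disjoint d.2 (closure (Prod.fst '' T))) := by
    intro T
    by_cases hT : T.Countable ∧ (∀ t ∈ T, IsGδ t.2 ∧ IsClosed t.2) ∧ (⋂ t ∈ T, t.2).Nonempty
    swap
    · obtain ⟨x₀⟩ : Nonempty X := inferInstance
      exact ⟨(x₀, Set.univ), fun h₁ h₂ => ⟨⟨IsGδ.univ, isClosed_univ⟩,
        fun h₃ => absurd ⟨h₁, h₂, h₃⟩ hT⟩⟩
    obtain ⟨hTc, hTG, hne⟩ := hT
    obtain ⟨x, hxT, hx⟩ := Set.not_subset.1 (h (⋂ t ∈ T, t.2) (Prod.fst '' T)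
      (IsGδ.biInter hTc fun t ht => (hTG t ht).1) hne (hTc.image _))
    obtain ⟨g, hg₀, hg₁, -⟩ := exists_continuous_zero_one_of_isClosed
      (isClosed_singleton (x := x)) (isClosed_closure (s := Prod.fst '' T))
      (Set.disjoint_singleton_left.2 hx)
    refine ⟨(x, g ⁻¹' {0}), fun _ _ => ⟨⟨(isClosed_singleton.isGδ).preimage g.continuous,
      isClosed_singleton.preimage g.continuous⟩, fun _ => ⟨hg₀ rfl, hxT, ?_⟩⟩⟩
    rw [Set.disjoint_left]
    intro z hz hz'
    have h₀ : g z = 0 := hz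
    have h₁ : g z = 1 := hg₁ hz'
    simp [h₀] at h₁
  choose F hF using step
  let I : Type := (ℵ_ 1).ord.ToType
  have : Uncountable I := uncountable_toType_ord_aleph_one
  have hI : ∀ i : I, (Set.Iio i).Countable := countable_Iio_toType_ord_aleph_one
  obtain ⟨f, hf⟩ := exists_forall_eq_image_Iio (I := I) F
  have hGc : ∀ i, IsGδ (f i).2 ∧ IsClosed (f i).2 := by
    intro i
    induction i using WellFoundedLT.induction with
    | ind i ih =>
      rw [hf]
      refine (hF (f '' Set.Iio i) ((hI i).image f) ?_).1
      rintro _ ⟨j, hj, rfl⟩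
      exact ih j hj
  have key := fun i => (hF (f '' Set.Iio i) ((hI i).image f)
    (by rintro _ ⟨j, _, rfl⟩; exact hGc j)).2
  simp only [← hf, Set.biInter_image, Set.image_image] at key
  have hne : ∀ i, (⋂ j ∈ Set.Iio i, (f j).2).Nonempty := by
    intro i
    induction i using WellFoundedLT.induction with
    | ind i ih =>
      rw [Set.biInter_eq_iInter]
      refine CompactSpace.iInter_nonempty (fun j => (hGc j).2) fun u => ?_
      rcases u.eq_empty_or_nonempty with rfl | hu
      · simp
      · obtain ⟨m, hm, hmax⟩ := u.exists_max_image id hu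
        obtain ⟨h₁, h₂, -⟩ := key m (ih m m.2)
        refine ⟨(f m).1, Set.mem_iInter₂.2 fun j hj => ?_⟩
        rcases (show j ≤ m from hmax j hj).eq_or_lt with rfl | hlt
        · exact h₁
        · exact Set.mem_iInter₂.1 h₂ j hlt
  obtain ⟨i, z, hz₁, hz₂⟩ :=
    exists_closure_Iio_inter_closure_Ici_nonempty hI tight fun i => (f i).1
  have hsub : closure ((fun i => (f i).1) '' Set.Ici i) ⊆ (f i).2 := by
    refine closure_minimal ?_ (hGc i).2
    rintro _ ⟨a, ha, rfl⟩
    obtain ⟨h₁, h₂, -⟩ := key a (hne a)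
    rcases (Set.mem_Ici.1 ha).eq_or_lt with rfl | hlt
    · exact h₁
    · exact Set.mem_iInter₂.1 h₂ i hlt
  exact Set.disjoint_left.1 (key i (hne i)).2.2 (hsub hz₂) hz₁

end CountablyTight

/-- A family of at most continuum many operations of countable arity has a nonempty closed set of
cardinality at most the continuum. -/
theorem exists_nonempty_closed_under_operations {X : Type*} [Nonempty X] {K : Type}
    (hK : #K ≤ 𝔠) (Φ : K → (ℕ → X) → X) :
    ∃ A : Set X, A.Nonempty ∧ #A ≤ 𝔠 ∧ ∀ k (a : ℕ → X), (∀ n, a n ∈ A) → Φ k a ∈ A := by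
  obtain ⟨x₀⟩ : Nonempty X := inferInstance
  let β : Option K → Type := fun o => o.elim Empty fun _ => ℕ
  let ev : (Σ o : Option K, β o → X) → X := fun
    | ⟨none, _⟩ => x₀
    | ⟨some k, a⟩ => Φ k a
  let e : WType β → X := WType.elim X ev
  have hW : #(WType β) ≤ 𝔠 := by
    refine WType.cardinalMk_le_of_le ?_
    have hle : ∀ o : Option K, 𝔠 ^ #(β o) ≤ 𝔠 := by
      rintro (_ | k)
      · simpa [β] using Cardinal.nat_lt_continuum 1 |>.le
      · simp [β]
    refine (Cardinal.sum_le_sum _ _ hle).trans ?_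
    rw [Cardinal.sum_const', Cardinal.mk_option]
    exact (mul_le_mul_left (add_le_add hK (Cardinal.nat_lt_continuum 1).le) _).trans (by simp)
  refine ⟨Set.range e, ⟨_, ⟨none, fun b => b.elim⟩, rfl⟩, ?_, fun k a ha => ?_⟩
  · have := Cardinal.mk_range_le_lift (f := e)
    rw [← Cardinal.lift_le_continuum.{_, 0}]
    simpa using this.trans (Cardinal.lift_le_continuum.2 hW)
  · choose w hw using ha
    refine ⟨⟨some k, w⟩, ?_⟩
    simp only [e, WType.elim, ev]
    congr 1
    exact funext hw

/-- If every point of a countably tight compact Hausdorff space lies in a `Gδ` set contained in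
the closure of a countable set, the space has density at most the continuum. -/
theorem exists_dense_mk_le_continuum {X : Type*} [TopologicalSpace X] [CompactSpace X] [T2Space X]
    (tight : ∀ (A : Set X) (x : X), x ∈ closure A → ∃ B ⊆ A, B.Countable ∧ x ∈ closure B)
    (U : X → ℕ → Set X) (hUo : ∀ x n, IsOpen (U x n)) (hU : ∀ x n, x ∈ U x n)
    (S : X → Set X) (hS : ∀ x, (S x).Countable) (hUS : ∀ x, ⋂ n, U x n ⊆ closure (S x)) :
    ∃ D : Set X, Dense D ∧ #D ≤ 𝔠 := by
  rcases isEmpty_or_nonempty X with hX | hX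
  · exact ⟨∅, fun x => hX.elim x, by simp⟩
  let P : (ℕ → Set ℕ) ⊕ Finset (ℕ × ℕ) → (ℕ → X) → X → Prop := fun k a x =>
    match k with
    | .inl B => ⋂ n, closure (a '' B n) ⊆ ⋂ n, U x n
    | .inr F => x ∉ ⋃ q ∈ F, U (a q.1) q.2
  have hch : ∀ k a, ∃ x, (∃ y, P k a y) → P k a x := by
    intro k a
    by_cases h : ∃ y, P k a y
    · exact ⟨h.choose, fun _ => h.choose_spec⟩
    · exact ⟨hX.some, fun h' => absurd h' h⟩
  choose Φ hΦ using hch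
  have hK : #((ℕ → Set ℕ) ⊕ Finset (ℕ × ℕ)) ≤ 𝔠 := by
    rw [Cardinal.mk_sum]
    simp
  obtain ⟨A, hAne, hAc, hA⟩ := exists_nonempty_closed_under_operations hK Φ
  refine ⟨⋃ x ∈ A, S x, ?_, ?_⟩
  · have hcover : ∀ y ∈ closure A, ∃ x ∈ A, y ∈ ⋂ n, U x n := by
      intro y hy
      obtain ⟨B, hBA, hBc, hyB⟩ := tight A y hy
      have hBne : B.Nonempty := closure_nonempty_iff.1 ⟨y, hyB⟩
      obtain ⟨a, rfl⟩ := hBc.exists_eq_range hBne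
      have hV : ∀ n, ∃ V ∈ 𝓝 y, IsClosed V ∧ V ⊆ U y n := fun n =>
        exists_mem_nhds_isClosed_subset ((hUo y n).mem_nhds (hU y n))
      choose V hV hVc hVU using hV
      have hyV : ∀ n, y ∈ closure (a '' (a ⁻¹' V n)) := by
        intro n
        rw [Set.image_preimage_eq_range_inter, mem_closure_iff_nhds]
        intro N hN
        obtain ⟨z, hz, hz'⟩ := mem_closure_iff_nhds.1 hyB _ (Filter.inter_mem hN (hV n))
        exact ⟨z, hz.1, hz', hz.2⟩
      have hP : P (.inl fun n => a ⁻¹' V n) a y :=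
        Set.iInter_mono fun n => (closure_minimal (Set.image_preimage_subset a _) (hVc n)).trans
          (hVU n)
      refine ⟨Φ (.inl fun n => a ⁻¹' V n) a, hA _ _ fun n => hBA ⟨n, rfl⟩, ?_⟩
      exact hΦ (.inl fun n => a ⁻¹' V n) a ⟨y, hP⟩ (Set.mem_iInter.2 hyV)
    have hall : ∀ z, ∃ x ∈ A, z ∈ ⋂ n, U x n := by
      intro z
      by_contra! hz
      let J := {q : A × ℕ // z ∉ U q.1 q.2}
      obtain ⟨t, ht⟩ := (isClosed_closure (s := A)).isCompact.elim_finite_subcover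
        (fun q : J => U q.1.1 q.1.2) (fun q => hUo _ _) (by
          intro y hy
          obtain ⟨x, hx, hyx⟩ := hcover y hy
          have := hz x hx
          rw [Set.mem_iInter, not_forall] at this
          obtain ⟨n, hn⟩ := this
          exact Set.mem_iUnion.2 ⟨⟨(⟨x, hx⟩, n), hn⟩, Set.mem_iInter.1 hyx n⟩)
      obtain ⟨x₀, hx₀⟩ := hAne
      let T : Set A := insert ⟨x₀, hx₀⟩ ((fun q : J => q.1.1) '' t)
      have hT : T.Countable := (t.countable_toSet.image _).insert _
      obtain ⟨b, hb⟩ := hT.exists_eq_range (Set.insert_nonempty _ _)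
      have hg : ∀ q ∈ t, ∃ i, b i = q.1.1 := fun q hq =>
        hb.subset (Set.mem_insert_of_mem _ ⟨q, hq, rfl⟩)
      choose! g hg using hg
      classical
      let F : Finset (ℕ × ℕ) := t.image fun q => (g q, q.1.2)
      let a : ℕ → X := fun i => b i
      have hP : P (.inr F) a z := by
        simp only [P, Set.mem_iUnion, not_exists]
        intro q hq hzq
        obtain ⟨r, hr, rfl⟩ := Finset.mem_image.1 hq
        simp only [a, hg r hr] at hzq
        exact r.2 hzq
      have hΦP := hΦ (.inr F) a ⟨z, hP⟩
      obtain ⟨q, hq, hmem⟩ := Set.mem_iUnion₂.1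
        (ht (subset_closure (hA (.inr F) a fun i => (b i).2)))
      refine hΦP (Set.mem_iUnion₂.2 ⟨_, Finset.mem_image_of_mem _ hq, ?_⟩)
      simpa only [a, hg q hq] using hmem
    intro z
    obtain ⟨x, hx, hz⟩ := hall z
    exact closure_mono (Set.subset_biUnion_of_mem hx) (hUS x hz)
  · refine (Cardinal.mk_biUnion_le _ _).trans ((mul_le_mul' hAc ?_).trans
      Cardinal.continuum_mul_aleph0.le)
    exact ciSup_le' fun x => (hS x).le_aleph0

/-- A homogeneous Hausdorff space of density at most the continuum and with a countable local
`π`-base at some point has cardinality at most the continuum. -/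
theorem mk_le_continuum_of_homogeneous {X : Type*} [TopologicalSpace X] [T2Space X]
    (homog : ∀ x y : X, ∃ f : X ≃ₜ X, f x = y) (p : X) {𝒢 : Set (Set X)} (h𝒢 : 𝒢.Countable)
    (h𝒢o : ∀ G ∈ 𝒢, IsOpen G ∧ G.Nonempty) (hp : ∀ U ∈ 𝓝 p, ∃ G ∈ 𝒢, G ⊆ U)
    {D : Set X} (hD : Dense D) (hDc : #D ≤ 𝔠) : #X ≤ 𝔠 := by
  choose h hh using homog p
  have hd : ∀ x (G : 𝒢), ∃ d : D, (d : X) ∈ h x '' G := by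
    intro x G
    obtain ⟨d, hd, hdD⟩ := hD.inter_open_nonempty _ ((h x).isOpenMap _ (h𝒢o G G.2).1)
      ((h𝒢o G G.2).2.image _)
    exact ⟨⟨d, hdD⟩, hd⟩
  choose d hd using hd
  have hinj : Function.Injective d := by
    intro x y hxy
    by_contra hne
    obtain ⟨V, W, hV, hW, hxV, hyW, hVW⟩ := t2_separation hne
    obtain ⟨G, hG, hGs⟩ := hp (h x ⁻¹' V ∩ h y ⁻¹' W) (Filter.inter_mem
      ((h x).continuous.continuousAt (hV.mem_nhds (by rwa [hh])))
      ((h y).continuous.continuousAt (hW.mem_nhds (by rwa [hh]))))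
    obtain ⟨a, ha, hax⟩ := hd x ⟨G, hG⟩
    obtain ⟨b, hb, hby⟩ := hd y ⟨G, hG⟩
    have hxd : (d x ⟨G, hG⟩ : X) ∈ V := by
      rw [← hax]
      exact (hGs ha).1
    have hyd : (d x ⟨G, hG⟩ : X) ∈ W := by
      rw [hxy, ← hby]
      exact (hGs hb).2
    exact Set.disjoint_left.1 hVW hxd hyd
  calc #X ≤ #(𝒢 → D) := Cardinal.mk_le_of_injective hinj
    _ = #D ^ #𝒢 := by simp
    _ ≤ 𝔠 ^ #𝒢 := Cardinal.power_le_power_right hDc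
    _ ≤ 𝔠 ^ ℵ₀ := Cardinal.power_le_power_left Cardinal.continuum_ne_zero h𝒢.le_aleph0
    _ = 𝔠 := Cardinal.continuum_power_aleph0

/-- Countable tightness, homogeneity and compact Hausdorff imply |X| ≤ 2^ℵ₀. -/
theorem cardinality_le_continuum_of_compact_homogeneous_countably_tight
    (X : Type*) [TopologicalSpace X] [CompactSpace X] [T2Space X]
    (homog : ∀ x y : X, ∃ f : X ≃ₜ X, f x = y)
    (tight : ∀ (A : Set X) (x : X), x ∈ closure A →
      ∃ B ⊆ A, B.Countable ∧ x ∈ closure B) :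
    Cardinal.mk X ≤ 2 ^ Cardinal.aleph0 := by
  rw [Cardinal.two_power_aleph0]
  rcases isEmpty_or_nonempty X with hX | hX
  · simp
  obtain ⟨G, S, hG, ⟨p, hpG⟩, hS, hGS⟩ := exists_isGδ_subset_closure_countable tight
  obtain ⟨V, hVo, rfl⟩ := hG.eq_iInter_nat
  choose h hh using homog p
  obtain ⟨D, hD, hDc⟩ := exists_dense_mk_le_continuum tight (fun x n => h x '' V n)
    (fun x n => (h x).isOpenMap _ (hVo n))
    (fun x n => ⟨p, Set.mem_iInter.1 hpG n, hh x⟩) (fun x => h x '' S)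
    (fun x => hS.image _) (fun x => by
      rw [← Set.image_iInter (h x).bijective, ← (h x).image_closure]
      exact Set.image_mono hGS)
  obtain ⟨𝒢, h𝒢, h𝒢o, hp⟩ := exists_countable_local_pi_base tight p
  exact mk_le_continuum_of_homogeneous homog p h𝒢 h𝒢o hp hD hDc
end

section
/- Assume 2^ℵ₀ < 2^ℵ₁. If X is a compact Hausdorff topological space that is homogeneous and has countable tightness, then X is first countable, i.e. every point of X has a countable neighborhood basis. -/
open Cardinal Topology

namespace CountablyTightCompact

open Set

universe u

variable {X : Type u} {I : Type u}

section WellOrder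

theorem exists_uncountable_wellOrder :
    ∃ (I : Type u) (_ : LinearOrder I) (_ : WellFoundedLT I),
      #I = ℵ₁ ∧ Uncountable I ∧ ∀ i : I, (Iio i).Countable := by
  have hcard : #((ℵ₁ : Cardinal.{u}).ord.ToType) = ℵ₁ := mk_ord_toType _
  refine ⟨(ℵ₁ : Cardinal.{u}).ord.ToType, inferInstance, inferInstance, hcard, ?_, fun i => ?_⟩
  · rw [← aleph0_lt_mk_iff, hcard]
    exact aleph0_lt_aleph_one
  · rw [← le_aleph0_iff_set_countable, ← Order.lt_succ_iff, succ_aleph0]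
    exact (mk_Iio_lt i (by simp)).trans_eq hcard

theorem exists_transfinite_rec [LinearOrder I] [WellFoundedLT I] {β : Type*}
    (step : I → Set β → β) : ∃ F : I → β, ∀ i, F i = step i (F '' Iio i) := by
  refine ⟨(wellFounded_lt (α := I)).fix fun i ih => step i {b | ∃ j, ∃ h : j < i, ih j h = b},
    fun i => ?_⟩
  rw [WellFounded.fix_eq]
  congr 1
  ext b
  simp

theorem exists_forall_lt_of_countable [LinearOrder I] [Uncountable I]
    (hI : ∀ i : I, (Iio i).Countable) {S : Set I} (hS : S.Countable) : ∃ i, ∀ s ∈ S, s < i := by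
  by_contra! h
  have hsub : (univ : Set I) ⊆ ⋃ s ∈ S, Iic s := fun i _ => by
    obtain ⟨s, hs, his⟩ := h i
    exact mem_biUnion hs his
  refine not_countable_univ ((hS.biUnion fun s _ => ?_).mono hsub)
  rw [← Iio_insert]
  exact (hI s).insert s

end WellOrder

section Cardinality

theorem mk_iUnion_le_continuum {ι : Type u} {s : ι → Set X} (hι : #ι ≤ 𝔠)
    (hs : ∀ i, #(s i) ≤ 𝔠) : #(⋃ i, s i) ≤ 𝔠 :=
  (mk_iUnion_le s).trans <| (mul_le_mul' hι (ciSup_le' hs)).trans_eq continuum_mul_self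

theorem mk_range_seq_prod_le_continuum {Y : Type u} {C : Type} (hY : #Y ≤ 𝔠) (hC : #C ≤ 𝔠)
    (f : (ℕ → Y) × C → X) : #(range f) ≤ 𝔠 := by
  refine mk_range_le.trans ?_
  have hC' : lift.{u} #C ≤ 𝔠 := by simpa using lift_le.{u}.2 hC
  have hseq : #(ℕ → Y) ≤ 𝔠 := by
    have := power_le_power_right (c := ℵ₀) hY
    simpa using this
  simpa using mul_le_mul' hseq hC'

/-- A set of size at most `𝔠` closed under `𝔠` many operations of countable arity. -/
theorem exists_closed_under_countable_operations {C : Type} (hC : #C ≤ 𝔠)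
    (Φ : (ℕ → X) → C → X) (y₀ : X) :
    ∃ Y : Set X, y₀ ∈ Y ∧ #Y ≤ 𝔠 ∧ ∀ a : ℕ → X, range a ⊆ Y → ∀ c, Φ a c ∈ Y := by
  obtain ⟨I, _, _, hcard, _, hI⟩ := exists_uncountable_wellOrder.{u}
  obtain ⟨F, hF⟩ := exists_transfinite_rec (I := I) fun _ (𝒦 : Set (Set X)) =>
    {y₀} ∪ {x | ∃ a c, range a ⊆ ⋃₀ 𝒦 ∧ Φ a c = x}
  have hbound : ∀ i, #(F i) ≤ 𝔠 := fun i => by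
    induction i using WellFoundedLT.induction with
    | ind i ih =>
      have hU : #(⋃₀ (F '' Iio i)) ≤ 𝔠 := by
        rw [sUnion_image, biUnion_eq_iUnion]
        refine mk_iUnion_le_continuum ?_ fun j => ih j j.2
        exact ((hI i).le_aleph0).trans aleph0_le_continuum
      rw [hF]
      refine (mk_union_le _ _).trans ?_
      refine add_le_of_le aleph0_le_continuum (by simpa using nat_lt_continuum 1 |>.le) ?_
      refine (mk_le_mk_of_subset ?_).trans (mk_range_seq_prod_le_continuum hU hC
        fun q => Φ (fun n => q.1 n) q.2)
      rintro x ⟨a, c, ha, rfl⟩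
      exact ⟨(fun n => ⟨a n, ha (mem_range_self n)⟩, c), rfl⟩
  refine ⟨⋃ i, F i, ?_, mk_iUnion_le_continuum (hcard.trans_le aleph_one_le_continuum) hbound,
    fun a ha c => ?_⟩
  · obtain ⟨i⟩ : Nonempty I := inferInstance
    refine mem_iUnion.2 ⟨i, ?_⟩
    rw [hF]
    exact Or.inl rfl
  · have ha' : ∀ n, ∃ i, a n ∈ F i := fun n => mem_iUnion.1 (ha (mem_range_self n))
    choose k hk using ha'
    obtain ⟨i, hi⟩ := exists_forall_lt_of_countable hI (countable_range k)
    refine mem_iUnion.2 ⟨i, ?_⟩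
    rw [hF]
    refine Or.inr ⟨a, c, ?_, rfl⟩
    rintro _ ⟨n, rfl⟩
    exact ⟨F (k n), mem_image_of_mem F (hi _ (mem_range_self n)), hk n⟩

end Cardinality

variable [TopologicalSpace X]

theorem not_free_sequence [CompactSpace X] [LinearOrder I] [Uncountable I]
    (hI : ∀ i : I, (Iio i).Countable)
    (tight : ∀ (A : Set X) (x : X), x ∈ closure A → ∃ B ⊆ A, B.Countable ∧ x ∈ closure B)
    (x : I → X) (C D : I → Set X) (hC : ∀ i, IsClosed (C i)) (hD : ∀ i, IsClosed (D i))
    (hCD : ∀ i, Disjoint (C i) (D i)) (hxC : ∀ i j, i < j → x j ∈ C i)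
    (hxD : ∀ i j, j < i → x j ∈ D i) : False := by
  have hne : (⋂ i, closure (x '' Ioi i)).Nonempty := by
    have : Nonempty I := inferInstance
    refine IsCompact.nonempty_iInter_of_directed_nonempty_isCompact_isClosed _ ?_ (fun i => ?_)
      (fun i => isClosed_closure.isCompact) fun i => isClosed_closure
    · intro i j
      exact ⟨max i j, closure_mono (image_mono (Ioi_subset_Ioi (le_max_left i j))),
        closure_mono (image_mono (Ioi_subset_Ioi (le_max_right i j)))⟩
    · obtain ⟨j, hj⟩ := exists_forall_lt_of_countable hI (countable_singleton i)
      exact ⟨x j, subset_closure ⟨j, hj i rfl, rfl⟩⟩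
  obtain ⟨z, hz⟩ := hne
  rw [mem_iInter] at hz
  obtain ⟨i₀⟩ : Nonempty I := inferInstance
  obtain ⟨B, hB, hBc, hzB⟩ := tight (range x) z (closure_mono (image_subset_range x _) (hz i₀))
  choose! k hk using fun b (hb : b ∈ B) => hB hb
  obtain ⟨i, hi⟩ := exists_forall_lt_of_countable hI (hBc.image k)
  have hzD : z ∈ D i := by
    refine closure_minimal (fun b hb => ?_) (hD i) hzB
    rw [← hk b hb]
    exact hxD i _ (hi _ (mem_image_of_mem k hb))
  have hzC : z ∈ C i := by
    refine closure_minimal ?_ (hC i) (hz i)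
    rintro _ ⟨j, hj, rfl⟩
    exact hxC i j hj
  exact disjoint_left.1 (hCD i) hzC hzD

section ClosedGδ

structure IsNonemptyClosedGδ (K : Set X) : Prop where
  nonempty : K.Nonempty
  isClosed : IsClosed K
  isGδ : IsGδ K

theorem exists_isClosed_isGδ_subset [CompactSpace X] [T2Space X] {x : X} {U : Set X}
    (hU : IsOpen U) (hx : x ∈ U) : ∃ Z ⊆ U, x ∈ Z ∧ IsClosed Z ∧ IsGδ Z := by
  obtain ⟨f, hf0, hf1, -⟩ := exists_continuous_zero_one_of_isClosed
    (isClosed_singleton (x := x)) hU.isClosed_compl (by simpa using hx)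
  refine ⟨f ⁻¹' {0}, fun y hy => ?_, hf0 rfl, isClosed_singleton.preimage f.continuous,
    isClosed_singleton.isGδ.preimage f.continuous⟩
  by_contra hyU
  have h1 : f y = 1 := hf1 hyU
  rw [mem_preimage, mem_singleton_iff, h1] at hy
  exact one_ne_zero hy

theorem IsNonemptyClosedGδ.exists_subset_open [CompactSpace X] [T2Space X] {K U : Set X}
    (hK : IsNonemptyClosedGδ K) (hU : IsOpen U) {x : X} (hxK : x ∈ K) (hxU : x ∈ U) :
    ∃ K' ⊆ K, IsNonemptyClosedGδ K' ∧ K' ⊆ U := by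
  obtain ⟨Z, hZU, hxZ, hZc, hZ⟩ := exists_isClosed_isGδ_subset hU hxU
  exact ⟨K ∩ Z, inter_subset_left, ⟨⟨x, hxK, hxZ⟩, hK.isClosed.inter hZc, hK.isGδ.inter hZ⟩,
    inter_subset_right.trans hZU⟩

theorem IsNonemptyClosedGδ.tower [CompactSpace X] [Nonempty X] [LinearOrder I] [WellFoundedLT I]
    (hI : ∀ i : I, (Iio i).Countable) {step : I → Set (Set X) → Set X} {F : I → Set X}
    (hF : ∀ i, F i = step i (F '' Iio i))
    (hstep : ∀ i 𝒦, 𝒦.Countable → IsNonemptyClosedGδ (⋂₀ 𝒦) →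
      IsNonemptyClosedGδ (step i 𝒦) ∧ step i 𝒦 ⊆ ⋂₀ 𝒦) (i : I) :
    IsNonemptyClosedGδ (⋂₀ (F '' Iio i)) ∧ IsNonemptyClosedGδ (F i) ∧ ∀ j < i, F i ⊆ F j := by
  induction i using WellFoundedLT.induction with
  | ind i ih =>
    have hinter : IsNonemptyClosedGδ (⋂₀ (F '' Iio i)) := by
      refine ⟨?_, ?_, ?_⟩
      · rcases (Iio i).eq_empty_or_nonempty with h | h
        · simp [h]
        · have : Nonempty (F '' Iio i) := (h.image F).to_subtype
          refine IsCompact.nonempty_sInter_of_directed_nonempty_isCompact_isClosed ?_ ?_ ?_ ?_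
          · rintro _ ⟨j, hj, rfl⟩ _ ⟨k, hk, rfl⟩
            rcases lt_trichotomy j k with h | rfl | h
            · exact ⟨F k, mem_image_of_mem F hk, (ih k hk).2.2 j h, subset_rfl⟩
            · exact ⟨F j, mem_image_of_mem F hk, subset_rfl, subset_rfl⟩
            · exact ⟨F j, mem_image_of_mem F hj, subset_rfl, (ih j hj).2.2 k h⟩
          all_goals rintro _ ⟨j, hj, rfl⟩
          · exact (ih j hj).2.1.nonempty
          · exact (ih j hj).2.1.isClosed.isCompact
          · exact (ih j hj).2.1.isClosed
      · refine isClosed_sInter ?_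
        rintro _ ⟨j, hj, rfl⟩
        exact (ih j hj).2.1.isClosed
      · refine IsGδ.sInter ?_ ((hI i).image F)
        rintro _ ⟨j, hj, rfl⟩
        exact (ih j hj).2.1.isGδ
    obtain ⟨h1, h2⟩ := hstep i _ ((hI i).image F) hinter
    rw [← hF] at h1 h2
    exact ⟨hinter, h1, fun j hj => h2.trans (sInter_subset_of_mem (mem_image_of_mem F hj))⟩

/-- A countably tight compact space has a nonempty closed `Gδ` set inside the closure of a
countable set. -/
theorem exists_isNonemptyClosedGδ_subset_closure_countable [CompactSpace X] [T2Space X]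
    [Nonempty X]
    (tight : ∀ (A : Set X) (x : X), x ∈ closure A → ∃ B ⊆ A, B.Countable ∧ x ∈ closure B) :
    ∃ K : Set X, IsNonemptyClosedGδ K ∧ ∃ S : Set X, S.Countable ∧ K ⊆ closure S := by
  obtain ⟨I, _, _, -, _, hI⟩ := exists_uncountable_wellOrder.{u}
  by_contra! h
  let pt : Set X → X := fun K => Classical.epsilon (· ∈ K)
  have hpt : ∀ K : Set X, K.Nonempty → pt K ∈ K := fun K hK => Classical.epsilon_spec hK
  have hstep : ∀ 𝒦 : Set (Set X), ∃ K' : Set X, 𝒦.Countable → IsNonemptyClosedGδ (⋂₀ 𝒦) →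
      (IsNonemptyClosedGδ K' ∧ K' ⊆ ⋂₀ 𝒦) ∧ Disjoint K' (closure (pt '' 𝒦)) := by
    intro 𝒦
    by_cases hc : 𝒦.Countable ∧ IsNonemptyClosedGδ (⋂₀ 𝒦)
    · obtain ⟨x, hxK, hx⟩ := not_subset.1 (h _ hc.2 (pt '' 𝒦) (hc.1.image pt))
      obtain ⟨K', hK', hK'P, hdisj⟩ := hc.2.exists_subset_open
        (isClosed_closure (s := pt '' 𝒦)).isOpen_compl hxK hx
      exact ⟨K', fun _ _ => ⟨⟨hK'P, hK'⟩, disjoint_left.2 hdisj⟩⟩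
    · exact ⟨∅, fun h1 h2 => (hc ⟨h1, h2⟩).elim⟩
  choose step hstep using hstep
  obtain ⟨F, hF⟩ := exists_transfinite_rec (I := I) fun _ => step
  have htower := IsNonemptyClosedGδ.tower hI hF fun _ 𝒦 h1 h2 => (hstep 𝒦 h1 h2).1
  refine not_free_sequence hI tight (fun i => pt (F i)) F
    (fun i => closure (pt '' (F '' Iio i))) (fun i => (htower i).2.1.isClosed)
    (fun i => isClosed_closure) (fun i => ?_) (fun i j hij => ?_) fun i j hji => ?_
  · have := (hstep _ ((hI i).image F) (htower i).1).2
    rwa [← hF] at this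
  · exact (htower j).2.2 i hij (hpt _ (htower j).2.1.nonempty)
  · exact subset_closure (mem_image_of_mem pt (mem_image_of_mem F hji))

/-- The Čech–Pospíšil theorem in its `ℵ₁` form. -/
theorem two_power_aleph_one_le_mk [CompactSpace X] [T2Space X] [Nonempty X]
    (h : ∀ x : X, ¬ IsGδ {x}) : 2 ^ ℵ₁ ≤ #X := by
  obtain ⟨I, _, _, hcard, _, hI⟩ := exists_uncountable_wellOrder.{u}
  have hsplit : ∀ 𝒦 : Set (Set X), ∃ A : Bool → Set X, IsNonemptyClosedGδ (⋂₀ 𝒦) →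
      (∀ b, IsNonemptyClosedGδ (A b) ∧ A b ⊆ ⋂₀ 𝒦) ∧ Disjoint (A true) (A false) := by
    intro 𝒦
    by_cases hK : IsNonemptyClosedGδ (⋂₀ 𝒦)
    · obtain ⟨x, hx⟩ := hK.nonempty
      obtain ⟨y, hy, hyx⟩ : ∃ y ∈ ⋂₀ 𝒦, y ≠ x := by
        by_contra! hsub
        exact h x ((eq_singleton_iff_unique_mem.2 ⟨hx, hsub⟩) ▸ hK.isGδ)
      obtain ⟨U, V, hU, hV, hyU, hxV, hUV⟩ := t2_separation hyx
      obtain ⟨K₁, hK₁, hP₁, hK₁U⟩ := hK.exists_subset_open hU hy hyU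
      obtain ⟨K₂, hK₂, hP₂, hK₂V⟩ := hK.exists_subset_open hV hx hxV
      refine ⟨fun b => cond b K₁ K₂, fun _ => ⟨?_, hUV.mono hK₁U hK₂V⟩⟩
      rintro (_ | _)
      exacts [⟨hP₂, hK₂⟩, ⟨hP₁, hK₁⟩]
    · exact ⟨fun _ => ∅, fun hK' => (hK hK').elim⟩
  choose A hA using hsplit
  have hrec : ∀ s : I → Bool, ∃ F : I → Set X, ∀ i, F i = A (F '' Iio i) (s i) := fun s =>
    exists_transfinite_rec fun i 𝒦 => A 𝒦 (s i)
  choose F hF using hrec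
  have htower := fun s => IsNonemptyClosedGδ.tower hI (hF s) fun i 𝒦 _ h2 => (hA 𝒦 h2).1 (s i)
  have hpoint : ∀ s, ∃ x, ∀ i, x ∈ F s i := by
    intro s
    have : (⋂ i, F s i).Nonempty := by
      have : Nonempty I := inferInstance
      refine IsCompact.nonempty_iInter_of_directed_nonempty_isCompact_isClosed _ ?_
        (fun i => (htower s i).2.1.nonempty) (fun i => (htower s i).2.1.isClosed.isCompact)
        fun i => (htower s i).2.1.isClosed
      refine Antitone.directed_ge fun i j hij => ?_
      rcases hij.eq_or_lt with rfl | hij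
      exacts [subset_rfl, (htower s j).2.2 i hij]
    obtain ⟨x, hx⟩ := this
    exact ⟨x, mem_iInter.1 hx⟩
  choose x hx using hpoint
  have hinj : Function.Injective x := by
    intro s t hst
    have key : ∀ i, s i = t i ∧ F s i = F t i := fun i => by
      induction i using WellFoundedLT.induction with
      | ind i ih =>
        have himage : F s '' Iio i = F t '' Iio i := image_congr fun j hj => (ih j hj).2
        have hsi : s i = t i := by
          have hd := (hA _ (htower s i).1).2
          have h1 := hx s i
          have h2 := hx t i
          rw [hF] at h1 h2
          rw [← himage, ← hst] at h2
          cases hs : s i <;> cases ht : t i <;> rw [hs] at h1 <;> rw [ht] at h2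
          exacts [(disjoint_left.1 hd h2 h1).elim, (disjoint_left.1 hd h1 h2).elim]
        exact ⟨hsi, by rw [hF s, hF t, himage, hsi]⟩
    exact funext fun i => (key i).1
  have := mk_le_of_injective hinj
  simpa [hcard] using this

end ClosedGδ

section LocalPiBase

/-- Every point of a countably tight compact space has a countable local π-base. -/
theorem exists_countable_local_piBase [CompactSpace X] [T2Space X]
    (tight : ∀ (A : Set X) (x : X), x ∈ closure A → ∃ B ⊆ A, B.Countable ∧ x ∈ closure B)
    (p : X) : ∃ 𝒰 : Set (Set X), 𝒰.Countable ∧ (∀ U ∈ 𝒰, IsOpen U ∧ U.Nonempty) ∧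
      ∀ W ∈ 𝓝 p, ∃ U ∈ 𝒰, U ⊆ W := by
  obtain ⟨I, _, _, -, _, hI⟩ := exists_uncountable_wellOrder.{u}
  by_contra! h
  let fam : Set (Set X × Set X) → Set (Set X) := fun 𝒬 => Prod.fst '' 𝒬 ∪ Prod.snd '' 𝒬
  have hstep : ∀ 𝒬 : Set (Set X × Set X), ∃ q : Set X × Set X, 𝒬.Countable →
      (∀ U ∈ fam 𝒬, IsOpen U) →
      (IsOpen q.1 ∧ IsOpen q.2 ∧ p ∈ q.1 ∧ Disjoint (closure q.1) (closure q.2)) ∧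
      ∀ 𝒮 : Set (Set X), 𝒮.Finite → 𝒮 ⊆ fam 𝒬 → (⋂₀ 𝒮).Nonempty → (⋂₀ 𝒮 ∩ q.2).Nonempty := by
    intro 𝒬
    by_cases hc : 𝒬.Countable ∧ ∀ U ∈ fam 𝒬, IsOpen U
    · obtain ⟨hc, ho⟩ := hc
      have hfam : (fam 𝒬).Countable := (hc.image _).union (hc.image _)
      obtain ⟨W, hW, hWU⟩ := h
        {V | V.Nonempty ∧ ∃ 𝒮 : Set (Set X), (𝒮.Finite ∧ 𝒮 ⊆ fam 𝒬) ∧ ⋂₀ 𝒮 = V}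
        ((((countable_ofPred_finite_subset hfam).image fun 𝒮 => ⋂₀ 𝒮)).mono fun V hV => hV.2)
        (by
          rintro _ ⟨hne, 𝒮, ⟨hfin, hsub⟩, rfl⟩
          exact ⟨hfin.isOpen_sInter fun U hU => ho U (hsub hU), hne⟩)
      obtain ⟨C, hCo, hpC, hCW⟩ := normal_exists_closure_subset (isClosed_singleton (x := p))
        isOpen_interior (singleton_subset_iff.2 (mem_interior_iff_mem_nhds.2 hW))
      obtain ⟨V, hVo, hCV, hVW⟩ := normal_exists_closure_subset isClosed_closure
        isOpen_interior hCW
      refine ⟨(C, (closure V)ᶜ), fun _ _ => ⟨⟨hCo, isClosed_closure.isOpen_compl, hpC rfl, ?_⟩,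
        fun 𝒮 hfin hsub hne => ?_⟩⟩
      · have hV : closure (closure V)ᶜ ⊆ Vᶜ :=
          closure_minimal (compl_subset_compl.2 subset_closure) hVo.isClosed_compl
        exact disjoint_left.2 fun x hxC hxV => hV hxV (hCV hxC)
      · obtain ⟨x, hxS, hxW⟩ := not_subset.1 (hWU _ ⟨hne, 𝒮, ⟨hfin, hsub⟩, rfl⟩)
        exact ⟨x, hxS, fun hxV => hxW (interior_subset (hVW hxV))⟩
    · exact ⟨(∅, ∅), fun h1 h2 => (hc ⟨h1, h2⟩).elim⟩
  choose step hstep using hstep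
  obtain ⟨F, hF⟩ := exists_transfinite_rec (I := I) fun _ => step
  have hprop : ∀ i, (IsOpen (F i).1 ∧ IsOpen (F i).2 ∧ p ∈ (F i).1 ∧
      Disjoint (closure (F i).1) (closure (F i).2)) ∧
      ∀ 𝒮 : Set (Set X), 𝒮.Finite → 𝒮 ⊆ fam (F '' Iio i) → (⋂₀ 𝒮).Nonempty →
        (⋂₀ 𝒮 ∩ (F i).2).Nonempty := fun i => by
    induction i using WellFoundedLT.induction with
    | ind i ih =>
      have := hstep (F '' Iio i) ((hI i).image F) (by
        rintro _ (⟨_, ⟨j, hj, rfl⟩, rfl⟩ | ⟨_, ⟨j, hj, rfl⟩, rfl⟩)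
        exacts [(ih j hj).1.1, (ih j hj).1.2.1])
      rwa [← hF] at this
  let E : I → I → Set X := fun i j => if j < i then (F j).1 else (F j).2
  have hE : ∀ i (T : Finset I), (⋂ j ∈ T, E i j).Nonempty := by
    intro i T
    induction T using Finset.induction_on_max with
    | empty => exact ⟨p, by simp⟩
    | insert m T hT ih =>
      by_cases hm : m < i
      · refine ⟨p, mem_iInter₂.2 fun j hj => ?_⟩
        have hji : j < i := by
          rcases Finset.mem_insert.1 hj with rfl | hj
          exacts [hm, (hT j hj).trans hm]
        simp only [E, if_pos hji]
        exact (hprop j).1.2.2.1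
      · have := (hprop m).2 (E i '' T) (T.finite_toSet.image _) (by
          rintro _ ⟨j, hj, rfl⟩
          by_cases hji : j < i
          · simp only [E, if_pos hji]
            exact Or.inl (mem_image_of_mem _ (mem_image_of_mem F (hT j hj)))
          · simp only [E, if_neg hji]
            exact Or.inr (mem_image_of_mem _ (mem_image_of_mem F (hT j hj)))) (by simpa using ih)
        obtain ⟨x, hxT, hxm⟩ := this
        refine ⟨x, mem_iInter₂.2 fun j hj => ?_⟩
        rcases Finset.mem_insert.1 hj with rfl | hj
        · simpa only [E, if_neg hm] using hxm
        · exact hxT _ (mem_image_of_mem _ hj)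
  have hpoint : ∀ i, ∃ x, ∀ j, x ∈ closure (E i j) := fun i => by
    obtain ⟨x, hx⟩ := CompactSpace.iInter_nonempty (t := fun j => closure (E i j))
      (fun j => isClosed_closure)
      fun T => (hE i T).mono (iInter₂_mono fun j _ => subset_closure)
    exact ⟨x, mem_iInter.1 hx⟩
  choose x hx using hpoint
  refine not_free_sequence hI tight x (fun i => closure (F i).1) (fun i => closure (F i).2)
    (fun i => isClosed_closure) (fun i => isClosed_closure) (fun i => (hprop i).1.2.2.2)
    (fun i j hij => ?_) fun i j hji => ?_
  · simpa only [E, if_pos hij] using hx j i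
  · simpa only [E, if_neg hji.not_gt] using hx j i

/-- In a homogeneous Hausdorff space, a dense set of size at most `𝔠` and a countable local
π-base bound the cardinality of the space by `𝔠`. -/
theorem mk_le_continuum_of_dense_of_local_piBase [T2Space X]
    (homog : ∀ x y : X, ∃ f : X ≃ₜ X, f x = y) {Y : Set X} (hY : Dense Y) (hYc : #Y ≤ 𝔠)
    {p : X} {𝒰 : Set (Set X)} (h𝒰 : 𝒰.Countable) (hne : ∀ U ∈ 𝒰, IsOpen U ∧ U.Nonempty)
    (hp : ∀ W ∈ 𝓝 p, ∃ U ∈ 𝒰, U ⊆ W) : #X ≤ 𝔠 := by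
  choose f hf using homog p
  have hd : ∀ x (U : 𝒰), ∃ d : Y, (d : X) ∈ f x '' U := fun x U => by
    obtain ⟨y, hyU, hyY⟩ := hY.inter_open_nonempty _ ((f x).isOpenMap _ (hne U U.2).1)
      ((hne U U.2).2.image _)
    exact ⟨⟨y, hyY⟩, hyU⟩
  choose d hd using hd
  have hinj : Function.Injective d := by
    intro x y hxy
    by_contra hne'
    obtain ⟨A, B, hA, hB, hxA, hyB, hAB⟩ := t2_separation hne'
    have hW : f x ⁻¹' A ∩ f y ⁻¹' B ∈ 𝓝 p := Filter.inter_mem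
      ((f x).continuous.continuousAt.preimage_mem_nhds (hA.mem_nhds (by rwa [hf])))
      ((f y).continuous.continuousAt.preimage_mem_nhds (hB.mem_nhds (by rwa [hf])))
    obtain ⟨U, hU, hUW⟩ := hp _ hW
    obtain ⟨u, hu, hud⟩ := hd x ⟨U, hU⟩
    obtain ⟨v, hv, hvd⟩ := hd y ⟨U, hU⟩
    refine disjoint_left.1 hAB (hUW hu).1 ?_
    rw [hud, hxy, ← hvd]
    exact (hUW hv).2
  calc #X ≤ #(𝒰 → Y) := mk_le_of_injective hinj
    _ = #Y ^ #𝒰 := by simp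
    _ ≤ 𝔠 ^ #𝒰 := power_le_power_right hYc
    _ ≤ 𝔠 ^ ℵ₀ := power_le_power_left continuum_ne_zero h𝒰.le_aleph0
    _ = 𝔠 := continuum_power_aleph0

end LocalPiBase

section Density

/-- A point in the closure of a sequence and in a `Gδ` set lies in a closed trace inside the `Gδ`
set, coded by countably many sets of indices. -/
theorem exists_trace_subset_iInter [CompactSpace X] [T2Space X] {a : ℕ → X} {z : X}
    (hz : z ∈ closure (range a)) {U : ℕ → Set X} (hU : ∀ n, IsOpen (U n)) (hzU : ∀ n, z ∈ U n) :
    ∃ T : ℕ → Set ℕ, z ∈ ⋂ n, closure (a '' T n) ∧ ⋂ n, closure (a '' T n) ⊆ ⋂ n, U n := by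
  have hV : ∀ n, ∃ V, IsOpen V ∧ z ∈ V ∧ closure V ⊆ U n := fun n => by
    obtain ⟨V, hV, hzV, hVU⟩ := normal_exists_closure_subset (isClosed_singleton (x := z)) (hU n)
      (singleton_subset_iff.2 (hzU n))
    exact ⟨V, hV, hzV rfl, hVU⟩
  choose V hVo hzV hVU using hV
  refine ⟨fun n => a ⁻¹' V n, mem_iInter.2 fun n => ?_, iInter_mono fun n => ?_⟩
  · rw [image_preimage_eq_inter_range]
    exact (hVo n).inter_closure ⟨hzV n, hz⟩
  · exact (closure_mono (image_preimage_subset a (V n))).trans (hVU n)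

/-- If every point of a countably tight compact space lies in a `Gδ` set contained in the closure
of a countable set, then the space has a dense subset of size at most `𝔠`. -/
theorem exists_dense_mk_le_continuum [CompactSpace X] [T2Space X] [Nonempty X]
    (tight : ∀ (A : Set X) (x : X), x ∈ closure A → ∃ B ⊆ A, B.Countable ∧ x ∈ closure B)
    (U : X → ℕ → Set X) (hU : ∀ x n, IsOpen (U x n)) (hxU : ∀ x n, x ∈ U x n)
    (S : X → ℕ → X) (hUS : ∀ x, ⋂ n, U x n ⊆ closure (range (S x))) :
    ∃ Y : Set X, Dense Y ∧ #Y ≤ 𝔠 := by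
  have hg : ∀ H : Set X, ∃ y, (∃ x, H ⊆ ⋂ n, U x n) → H ⊆ ⋂ n, U y n := fun H => by
    by_cases h : ∃ x, H ⊆ ⋂ n, U x n
    · exact ⟨h.choose, fun _ => h.choose_spec⟩
    · exact ⟨Classical.arbitrary X, fun h' => (h h').elim⟩
  choose g hg using hg
  have hout : ∀ A : Set X, ∃ y, A ≠ Set.univ → y ∉ A := fun A => by
    by_cases h : A = Set.univ
    · exact ⟨Classical.arbitrary X, fun h' => (h' h).elim⟩
    · obtain ⟨y, hy⟩ := (ne_univ_iff_exists_notMem A).1 h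
      exact ⟨y, fun _ => hy⟩
  choose out hout using hout
  let H : (ℕ → X) → (ℕ → Set ℕ) → Set X := fun a T => ⋂ n, closure (a '' T n)
  let Code : Type := Finset ((ℕ → Set ℕ) × ℕ) ⊕ ((ℕ → Set ℕ) × ℕ)
  have hpair : #((ℕ → Set ℕ) × ℕ) = 𝔠 := by simp
  have hCode : #Code ≤ 𝔠 := by
    simp only [Code, mk_sum, lift_id, mk_finset_of_infinite, hpair, continuum_add_self, le_refl]
  obtain ⟨y₀⟩ := ‹Nonempty X›
  obtain ⟨Y, hy₀, hYc, hY⟩ := exists_closed_under_countable_operations hCode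
    (fun a c => Sum.elim (fun L => out (⋃ q ∈ L, U (g (H a q.1)) q.2))
      (fun q => S (g (H a q.1)) q.2) c) y₀
  have hYout : ∀ a : ℕ → X, range a ⊆ Y → ∀ L : Finset ((ℕ → Set ℕ) × ℕ),
      out (⋃ q ∈ L, U (g (H a q.1)) q.2) ∈ Y := fun a ha L => hY a ha (Sum.inl L)
  have hYS : ∀ a : ℕ → X, range a ⊆ Y → ∀ T n, S (g (H a T)) n ∈ Y := fun a ha T n =>
    hY a ha (Sum.inr (T, n))
  refine ⟨Y, fun q => ?_, hYc⟩
  by_contra hq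
  have hcover : ∀ z ∈ closure Y, ∃ a : ℕ → X, range a ⊆ Y ∧ ∃ T n,
      z ∈ U (g (H a T)) n ∧ q ∉ U (g (H a T)) n := by
    intro z hz
    obtain ⟨B, hBY, hB, hzB⟩ := tight Y z hz
    obtain ⟨a, rfl⟩ := hB.exists_eq_range (closure_nonempty_iff.1 ⟨z, hzB⟩)
    obtain ⟨T, hzT, hT⟩ := exists_trace_subset_iInter hzB (hU z) (hxU z)
    have hgT : H a T ⊆ ⋂ n, U (g (H a T)) n := hg _ ⟨z, hT⟩
    have hqU : q ∉ ⋂ n, U (g (H a T)) n := fun hqU => hq <|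
      closure_mono (range_subset_iff.2 (hYS a hBY T)) (hUS _ hqU)
    obtain ⟨n, hn⟩ := not_forall.1 (mt mem_iInter.2 hqU)
    exact ⟨a, hBY, T, n, mem_iInter.1 (hgT hzT) n, hn⟩
  choose! a haY T n hzU hqU using hcover
  obtain ⟨t, htY, ht⟩ := (isClosed_closure (s := Y)).isCompact.elim_nhds_subcover
    (fun z => U (g (H (a z) (T z))) (n z)) fun z hz => (hU _ _).mem_nhds (hzU z hz)
  obtain ⟨b, hb⟩ : ∃ b : ℕ → X, insert y₀ (⋃ z ∈ t, range (a z)) = range b :=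
    ((t.countable_toSet.biUnion fun z _ => countable_range (a z)).insert y₀).exists_eq_range
      (insert_nonempty _ _)
  have hbY : range b ⊆ Y := by
    rw [← hb]
    exact insert_subset hy₀ (iUnion₂_subset fun z hz => haY z (htY z hz))
  have hHb : ∀ z ∈ t, H b (fun k => b ⁻¹' (a z '' T z k)) = H (a z) (T z) := fun z hz => by
    refine iInter_congr fun k => ?_
    rw [image_preimage_eq_of_subset]
    rw [← hb]
    exact (image_subset_range _ _).trans <|
      (subset_biUnion_of_mem (u := fun z => range (a z)) hz).trans (subset_insert _ _)
  classical
  let L : Finset ((ℕ → Set ℕ) × ℕ) := t.image fun z => (fun k => b ⁻¹' (a z '' T z k), n z)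
  have hL : ⋃ q ∈ L, U (g (H b q.1)) q.2 = ⋃ z ∈ t, U (g (H (a z) (T z))) (n z) := by
    simp only [L, Finset.set_biUnion_finset_image]
    exact iUnion₂_congr fun z hz => by rw [hHb z hz]
  have hmem := hYout b hbY L
  rw [hL] at hmem
  refine hout _ (fun huniv => ?_) (ht (subset_closure hmem))
  have hq' : q ∈ ⋃ z ∈ t, U (g (H (a z) (T z))) (n z) := huniv ▸ mem_univ q
  obtain ⟨z, hz, hqz⟩ := mem_iUnion₂.1 hq'
  exact hqU z (htY z hz) hqz

end Density

theorem isCountablyGenerated_nhds_of_isGδ_singleton [CompactSpace X] [T2Space X] {x : X}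
    (hx : IsGδ {x}) : (𝓝 x).IsCountablyGenerated := by
  obtain ⟨U, hU, hxU⟩ := isGδ_iff_eq_iInter_nat.1 hx
  have hV : ∀ n, ∃ V ∈ 𝓝 x, IsClosed V ∧ V ⊆ U n := fun n =>
    exists_mem_nhds_isClosed_subset <| (hU n).mem_nhds <| mem_iInter.1 (hxU ▸ mem_singleton x) n
  choose V hVx hVc hVU using hV
  have hanti : Antitone fun n => ⋂ k ∈ Iic n, V k := fun m n hmn =>
    biInter_subset_biInter_left (Iic_subset_Iic.2 hmn)
  have hbasis : (𝓝 x).HasBasis (fun _ : ℕ => True) fun n => ⋂ k ∈ Iic n, V k := by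
    refine ⟨fun W => ⟨fun hW => ?_, fun ⟨n, _, hn⟩ => Filter.mem_of_superset
      ((Filter.biInter_mem (finite_Iic n)).2 fun k _ => hVx k) hn⟩⟩
    obtain ⟨n, hn⟩ := exists_subset_nhds_of_isCompact (V := fun n => ⋂ k ∈ Iic n, V k)
      hanti.directed_ge (fun n => (isClosed_biInter fun k _ => hVc k).isCompact) (U := W) (by
        intro y hy
        have hyx : y ∈ ({x} : Set X) := by
          rw [hxU]
          exact mem_iInter.2 fun n => hVU n (mem_iInter₂.1 (mem_iInter.1 hy n) n (mem_Iic.2 le_rfl))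
        rwa [mem_singleton_iff.1 hyx])
    exact ⟨n, trivial, hn⟩
  exact hbasis.isCountablyGenerated

/-- De la Vega's theorem for countable tightness. -/
theorem mk_le_continuum_of_homogeneous [CompactSpace X] [T2Space X] [Nonempty X]
    (homog : ∀ x y : X, ∃ f : X ≃ₜ X, f x = y)
    (tight : ∀ (A : Set X) (x : X), x ∈ closure A → ∃ B ⊆ A, B.Countable ∧ x ∈ closure B) :
    #X ≤ 𝔠 := by
  obtain ⟨K, hK, S, hS, hKS⟩ := exists_isNonemptyClosedGδ_subset_closure_countable tight
  obtain ⟨p, hp⟩ := hK.nonempty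
  obtain ⟨s, rfl⟩ := hS.exists_eq_range (closure_nonempty_iff.1 ⟨p, hKS hp⟩)
  obtain ⟨V, hV, rfl⟩ := isGδ_iff_eq_iInter_nat.1 hK.isGδ
  choose f hf using fun x => homog x p
  obtain ⟨Y, hY, hYc⟩ := exists_dense_mk_le_continuum tight (fun x n => f x ⁻¹' V n)
    (fun x n => (hV n).preimage (f x).continuous)
    (fun x n => by simpa only [mem_preimage, hf] using mem_iInter.1 hp n)
    (fun x n => (f x).symm (s n)) fun x => by
      rw [← preimage_iInter, range_comp' (f x).symm s, ← (f x).symm.image_closure]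
      rw [(f x).symm.image_eq_preimage_symm]
      exact preimage_mono hKS
  obtain ⟨𝒰, h𝒰, hne, hπ⟩ := exists_countable_local_piBase tight p
  exact mk_le_continuum_of_dense_of_local_piBase homog hY hYc h𝒰 hne hπ

theorem two_power_aleph0_lt_two_power_aleph_one_lift.{v, w}
    (h : (2 : Cardinal.{v}) ^ ℵ₀ < 2 ^ ℵ₁) : (2 : Cardinal.{w}) ^ ℵ₀ < 2 ^ ℵ₁ := by
  have h' := lift_lt.{v, w}.2 h
  refine lift_lt.{w, v}.1 ?_
  simpa using h'

end CountablyTightCompact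

/-- Assuming 2^ℵ₀ < 2^ℵ₁, a compact homogeneous Hausdorff space of countable
tightness is first countable. -/
theorem firstCountable_of_compact_homogeneous_countably_tight
    (hcard : (2 : Cardinal) ^ Cardinal.aleph0 < 2 ^ Cardinal.aleph 1)
    (X : Type*) [TopologicalSpace X] [CompactSpace X] [T2Space X]
    (homog : ∀ x y : X, ∃ f : X ≃ₜ X, f x = y)
    (tight : ∀ (A : Set X) (x : X), x ∈ closure A →
      ∃ B ⊆ A, B.Countable ∧ x ∈ closure B) :
    FirstCountableTopology X := by
  refine ⟨fun x => ?_⟩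
  have : Nonempty X := ⟨x⟩
  obtain ⟨y, hy⟩ : ∃ y : X, IsGδ {y} := by
    by_contra! h
    have hle := (CountablyTightCompact.two_power_aleph_one_le_mk h).trans
      (CountablyTightCompact.mk_le_continuum_of_homogeneous homog tight)
    rw [← two_power_aleph0] at hle
    exact hle.not_gt
      (CountablyTightCompact.two_power_aleph0_lt_two_power_aleph_one_lift hcard)
  obtain ⟨f, rfl⟩ := homog x y
  refine CountablyTightCompact.isCountablyGenerated_nhds_of_isGδ_singleton ?_
  have := hy.preimage f.continuous
  rwa [← Set.image_singleton, f.preimage_image] at this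
end

section
/- If X is a nonempty compact Hausdorff topological space of countable tightness, then there exist a countable subset S of X and a nonempty closed Gδ subset H of X such that H is contained in the closure of S. -/
open Topology

open Set

/-- There is an uncountable well-order all of whose proper initial segments are countable. -/
theorem exists_uncountable_wellOrder_countable_Iio :
    ∃ (ι : Type) (_ : LinearOrder ι) (_ : WellFoundedLT ι),
      Uncountable ι ∧ ∀ a : ι, (Iio a).Countable := by
  refine ⟨(Cardinal.aleph 1).ord.ToType, inferInstance, inferInstance, ?_, fun a => ?_⟩
  · rw [← Cardinal.aleph0_lt_mk_iff, Cardinal.mk_toType, Cardinal.card_ord]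
    exact Cardinal.aleph0_lt_aleph_one
  · rw [← Cardinal.le_aleph0_iff_set_countable, ← Order.lt_succ_iff, Cardinal.succ_aleph0]
    exact (Cardinal.mk_Iio_lt a (by simp)).trans_eq (by simp)

theorem Set.Countable.exists_forall_lt_of_countable_Iio {ι : Type*} [LinearOrder ι]
    [Uncountable ι] (h : ∀ a : ι, (Iio a).Countable) {C : Set ι} (hC : C.Countable) :
    ∃ c, ∀ a ∈ C, a < c := by
  by_contra! hne
  refine not_countable_univ (α := ι) ?_
  refine (hC.biUnion fun a _ => (h a).insert a).mono fun c _ => ?_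
  obtain ⟨a, ha, hca⟩ := hne c
  exact mem_biUnion ha hca.eq_or_lt

theorem exists_isClosed_isGδ_disjoint {X : Type*} [TopologicalSpace X] [NormalSpace X]
    [T1Space X] {F : Set X} (hF : IsClosed F) {p : X} (hp : p ∉ F) :
    ∃ G : Set X, p ∈ G ∧ IsClosed G ∧ IsGδ G ∧ Disjoint F G := by
  obtain ⟨f, hf0, hf1, -⟩ := exists_continuous_zero_one_of_isClosed hF
    (isClosed_singleton (x := p)) (disjoint_singleton_right.2 hp)
  refine ⟨f ⁻¹' {1}, hf1 rfl, isClosed_singleton.preimage f.continuous,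
    (isClosed_singleton.isGδ).preimage f.continuous, ?_⟩
  exact Set.disjoint_left.2 fun y hy hy1 => zero_ne_one ((hf0 hy).symm.trans hy1)

/-- If no nonempty closed Gδ set lies in the closure of a countable set, then along every
well-order with countable initial segments there are points `x a` and a decreasing family of
closed sets `H a` such that `x a ∈ H a` and `H a` misses the closure of `{x b | b < a}`. -/
theorem exists_points_antitone_closed_of_not_subset_closure {X : Type*} [TopologicalSpace X]
    [CompactSpace X] [T2Space X] [Nonempty X]
    (hX : ∀ S K : Set X, S.Countable → K.Nonempty → IsClosed K → IsGδ K → ¬ K ⊆ closure S)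
    {ι : Type*} [LinearOrder ι] [WellFoundedLT ι] (hι : ∀ a : ι, (Iio a).Countable) :
    ∃ (x : ι → X) (H : ι → Set X), (∀ a, x a ∈ H a) ∧ (∀ a, IsClosed (H a)) ∧ Antitone H ∧
      ∀ a, Disjoint (closure (x '' Iio a)) (H a) := by
  have step : ∀ P : Set X × Set X, ∃ q : X × Set X,
      P.1.Countable → P.2.Nonempty → IsClosed P.2 → IsGδ P.2 →
        q.1 ∈ q.2 ∧ q.2 ⊆ P.2 ∧ IsClosed q.2 ∧ IsGδ q.2 ∧ Disjoint (closure P.1) q.2 := by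
    rintro ⟨S, K⟩
    by_cases h : S.Countable ∧ K.Nonempty ∧ IsClosed K ∧ IsGδ K
    · obtain ⟨hS, hne, hK, hKG⟩ := h
      obtain ⟨p, hpK, hpS⟩ := Set.not_subset.1 (hX S K hS hne hK hKG)
      obtain ⟨G, hpG, hG, hGG, hd⟩ := exists_isClosed_isGδ_disjoint isClosed_closure hpS
      exact ⟨(p, K ∩ G), fun _ _ _ _ => ⟨⟨hpK, hpG⟩, inter_subset_left, hK.inter hG,
        hKG.inter hGG, hd.mono_right inter_subset_right⟩⟩
    · exact ⟨(Classical.arbitrary X, ∅), fun h1 h2 h3 h4 => (h ⟨h1, h2, h3, h4⟩).elim⟩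
  choose g hg using step
  obtain ⟨f, hf⟩ : ∃ f : ι → X × Set X, ∀ a,
      f a = g ((fun b => (f b).1) '' Iio a, ⋂ b ∈ Iio a, (f b).2) := by
    refine ⟨wellFounded_lt.fix fun a F =>
      g (range fun b : Iio a => (F b b.2).1, ⋂ b : Iio a, (F b b.2).2), fun a => ?_⟩
    rw [WellFounded.fix_eq, image_eq_range, biInter_eq_iInter]
  have key : ∀ a, (f a).1 ∈ (f a).2 ∧ (f a).2 ⊆ (⋂ b ∈ Iio a, (f b).2) ∧ IsClosed (f a).2 ∧
      IsGδ (f a).2 ∧ Disjoint (closure ((fun b => (f b).1) '' Iio a)) (f a).2 := by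
    intro a
    induction a using WellFoundedLT.induction with
    | ind a ih =>
      have hanti : ∀ b c : Iio a, b ≤ c → (f c).2 ⊆ (f b).2 := by
        intro b c hbc
        rcases hbc.eq_or_lt with rfl | hlt
        · exact Subset.rfl
        · exact (ih c c.2).2.1.trans (biInter_subset_of_mem (mem_Iio.2 hlt))
      have hne : (⋂ b ∈ Iio a, (f b).2).Nonempty := by
        rw [biInter_eq_iInter]
        cases isEmpty_or_nonempty (Iio a)
        · rw [iInter_of_empty]; exact univ_nonempty
        · exact IsCompact.nonempty_iInter_of_directed_nonempty_isCompact_isClosed _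
            (directed_of_isDirected_le hanti)
            (fun b => ⟨_, (ih b b.2).1⟩) (fun b => (ih b b.2).2.2.1.isCompact)
            (fun b => (ih b b.2).2.2.1)
      have := hg ((fun b => (f b).1) '' Iio a, ⋂ b ∈ Iio a, (f b).2) ((hι a).image _) hne
        (isClosed_biInter fun b hb => (ih b hb).2.2.1)
        (IsGδ.biInter (hι a) fun b hb => (ih b hb).2.2.2.1)
      rwa [← hf a] at this
  refine ⟨fun a => (f a).1, fun a => (f a).2, fun a => (key a).1, fun a => (key a).2.2.1, ?_,
    fun a => (key a).2.2.2.2⟩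
  intro b c hbc
  rcases hbc.eq_or_lt with rfl | hlt
  · exact Subset.rfl
  · exact (key c).2.1.trans (biInter_subset_of_mem (mem_Iio.2 hlt))

/-- In a nonempty compact Hausdorff space of countable tightness there are a
countable set S and a nonempty closed Gδ set H with H ⊆ closure S. -/
theorem exists_closed_gdelta_subset_closure_countable
    (X : Type*) [TopologicalSpace X] [CompactSpace X] [T2Space X] [Nonempty X]
    (tight : ∀ (A : Set X) (x : X), x ∈ closure A →
      ∃ B ⊆ A, B.Countable ∧ x ∈ closure B) :
    ∃ (S : Set X) (H : Set X), S.Countable ∧ H.Nonempty ∧ IsClosed H ∧ IsGδ H ∧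
      H ⊆ closure S := by
  by_contra! hX
  obtain ⟨ι, _, _, _, hι⟩ := exists_uncountable_wellOrder_countable_Iio
  obtain ⟨x, H, hxH, hH, hanti, hdisj⟩ :=
    exists_points_antitone_closed_of_not_subset_closure hX hι
  have hmem : ∀ a, x a ∈ closure (range x) ∩ H a :=
    fun a => ⟨subset_closure (mem_range_self a), hxH a⟩
  have hclosed : ∀ a, IsClosed (closure (range x) ∩ H a) := fun a => isClosed_closure.inter (hH a)
  obtain ⟨y, hy⟩ := IsCompact.nonempty_iInter_of_directed_nonempty_isCompact_isClosed
    (fun a => closure (range x) ∩ H a)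
    (directed_of_isDirected_le fun _ _ hab => inter_subset_inter_right _ (hanti hab))
    (fun a => ⟨_, hmem a⟩) (fun a => (hclosed a).isCompact) hclosed
  rw [mem_iInter] at hy
  obtain ⟨B, hBx, hB, hyB⟩ := tight _ y (hy (Classical.arbitrary ι)).1
  choose! r hr using show ∀ b ∈ B, ∃ a, x a = b from fun _ hb => hBx hb
  obtain ⟨c, hc⟩ := (hB.image r).exists_forall_lt_of_countable_Iio hι
  have hBc : B ⊆ x '' Iio c := fun b hb => ⟨r b, hc _ (mem_image_of_mem r hb), hr b hb⟩
  exact Set.disjoint_left.1 (hdisj c) (closure_mono hBc hyB) (hy c).2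
end

section
/- If X is a compact Hausdorff topological space that is homogeneous and has countable tightness, then for every point p of X there exist a countable subset S of X and a closed Gδ subset H of X such that p ∈ H and H is contained in the closure of S. -/
open Topology

/-- In a normal space, every point of an open set lies in a closed Gδ subset of it. -/
theorem IsOpen.exists_isClosed_isGδ_mem_subset {X : Type*} [TopologicalSpace X] [NormalSpace X]
    [T1Space X] {U : Set X} (hU : IsOpen U) {x : X} (hx : x ∈ U) :
    ∃ H : Set X, IsClosed H ∧ IsGδ H ∧ x ∈ H ∧ H ⊆ U := by
  obtain ⟨f, hf0, hf1, -⟩ := exists_continuous_zero_one_of_isClosed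
    (isClosed_singleton (x := x)) hU.isClosed_compl
    (Set.disjoint_singleton_left.2 fun h => h hx)
  refine ⟨f ⁻¹' {0}, isClosed_singleton.preimage f.continuous,
    isClosed_singleton.isGδ.preimage f.continuous, hf0 rfl, fun y hy => ?_⟩
  by_contra hyU
  have h1 := hf1 hyU
  rw [Set.mem_preimage, Set.mem_singleton_iff] at hy
  simp [hy] at h1

/-- There is an uncountable well-order all of whose proper initial segments are countable. -/
theorem exists_wellOrder_uncountable_countable_Iio :
    ∃ (I : Type) (_ : LinearOrder I) (_ : WellFoundedLT I),
      Uncountable I ∧ ∀ i : I, (Set.Iio i).Countable := by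
  refine ⟨(Cardinal.aleph 1).ord.ToType, inferInstance, inferInstance, ?_, fun i => ?_⟩
  · rw [← Cardinal.aleph0_lt_mk_iff, Cardinal.mk_ord_toType]
    exact Cardinal.aleph0_lt_aleph_one
  · have h := Cardinal.mk_Iio_lt i (by simp)
    rw [Cardinal.mk_ord_toType] at h
    exact Cardinal.le_aleph0_iff_set_countable.1 (Cardinal.lt_aleph_one_iff.1 h)

/-- A countable set in an uncountable linear order with countable proper initial segments
has a strict upper bound. -/
theorem Set.Countable.exists_subset_Iio {I : Type*} [LinearOrder I] [Uncountable I]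
    (hI : ∀ i : I, (Set.Iio i).Countable) {J : Set I} (hJ : J.Countable) :
    ∃ i, J ⊆ Set.Iio i := by
  by_contra! h
  refine Set.not_countable_univ (α := I) ((hJ.biUnion fun j _ => (hI j).insert j).mono ?_)
  intro i _
  obtain ⟨j, hj, hij⟩ := Set.not_subset.1 (h i)
  exact Set.mem_biUnion hj ((not_lt.1 hij).eq_or_lt)

/-- Transfinite construction of points in a decreasing family of closed sets, each avoiding the
closure of the earlier points, when no nonempty closed Gδ set is contained in the closure of a
countable set. -/
theorem exists_points_closed_avoiding_closure {X : Type*} [TopologicalSpace X] [CompactSpace X]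
    [T2Space X] [Nonempty X]
    (h : ∀ S H : Set X, S.Countable → IsClosed H → IsGδ H → H.Nonempty → ¬ H ⊆ closure S)
    {I : Type*} [LinearOrder I] [WellFoundedLT I] (hI : ∀ i : I, (Set.Iio i).Countable) :
    ∃ (x : I → X) (F : I → Set X), (∀ i, IsClosed (F i)) ∧ (∀ i, x i ∈ F i) ∧ Antitone F ∧
      ∀ i, Disjoint (F i) (closure (x '' Set.Iio i)) := by
  have step : ∀ P : Set (X × Set X), ∃ q : X × Set X, P.Countable →
      (∀ r ∈ P, IsClosed r.2 ∧ IsGδ r.2) → (⋂ r ∈ P, r.2).Nonempty →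
      IsClosed q.2 ∧ IsGδ q.2 ∧ q.1 ∈ q.2 ∧ q.2 ⊆ (⋂ r ∈ P, r.2) ∧
        Disjoint q.2 (closure (Prod.fst '' P)) := by
    intro P
    by_cases hP : P.Countable ∧ (∀ r ∈ P, IsClosed r.2 ∧ IsGδ r.2) ∧ (⋂ r ∈ P, r.2).Nonempty
    · obtain ⟨hc, hr, hne⟩ := hP
      have hcl : IsClosed (⋂ r ∈ P, r.2) := isClosed_biInter fun r hrP => (hr r hrP).1
      have hG : IsGδ (⋂ r ∈ P, r.2) := IsGδ.biInter hc fun r hrP => (hr r hrP).2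
      obtain ⟨x, hx, hxS⟩ := Set.not_subset.1 (h _ _ (hc.image Prod.fst) hcl hG hne)
      obtain ⟨H, hH, hHG, hxH, hHS⟩ :=
        isClosed_closure.isOpen_compl.exists_isClosed_isGδ_mem_subset hxS
      exact ⟨(x, (⋂ r ∈ P, r.2) ∩ H), fun _ _ _ => ⟨hcl.inter hH, hG.inter hHG, ⟨hx, hxH⟩,
        Set.inter_subset_left,
        (Set.disjoint_left.2 fun y hy => hHS hy).mono_left Set.inter_subset_right⟩⟩
    · exact ⟨(Classical.arbitrary X, ∅), fun h1 h2 h3 => (hP ⟨h1, h2, h3⟩).elim⟩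
  choose g hg using step
  obtain ⟨u, hu⟩ : ∃ u : I → X × Set X, ∀ i, u i = g (u '' Set.Iio i) := by
    refine ⟨(wellFounded_lt (α := I)).fix fun i v => g {r | ∃ j, ∃ hj : j < i, v j hj = r},
      fun i => ?_⟩
    rw [WellFounded.fix_eq]
    congr 1
    ext r
    simp
  have key : ∀ i, IsClosed (u i).2 ∧ IsGδ (u i).2 ∧ (u i).1 ∈ (u i).2 ∧
      (u i).2 ⊆ (⋂ r ∈ u '' Set.Iio i, r.2) ∧
        Disjoint (u i).2 (closure (Prod.fst '' (u '' Set.Iio i))) := by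
    intro i
    induction i using WellFoundedLT.induction with
    | ind i ih =>
      have hanti : ∀ j < i, ∀ k < j, (u j).2 ⊆ (u k).2 := fun j hj k hk =>
        (ih j hj).2.2.2.1.trans (Set.biInter_subset_of_mem (Set.mem_image_of_mem u hk))
      have hne : (⋂ r ∈ u '' Set.Iio i, r.2).Nonempty := by
        rw [Set.biInter_image, Set.biInter_eq_iInter]
        rcases isEmpty_or_nonempty (Set.Iio i) with hE | hE
        · simp
        · refine IsCompact.nonempty_iInter_of_directed_nonempty_isCompact_isClosed _ ?_
            (fun j => ⟨_, (ih j j.2).2.2.1⟩) (fun j => (ih j j.2).1.isCompact)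
            (fun j => (ih j j.2).1)
          refine Antitone.directed_ge fun j k hjk => ?_
          rcases hjk.eq_or_lt with rfl | hlt
          · exact subset_rfl
          · exact hanti k k.2 j hlt
      have := hg (u '' Set.Iio i) ((hI i).image u)
        (by rintro _ ⟨j, hj, rfl⟩; exact ⟨(ih j hj).1, (ih j hj).2.1⟩) hne
      rwa [← hu i] at this
  refine ⟨fun i => (u i).1, fun i => (u i).2, fun i => (key i).1, fun i => (key i).2.2.1,
    fun j k hjk => ?_, fun i => ?_⟩
  · rcases hjk.eq_or_lt with rfl | hlt
    · exact subset_rfl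
    · exact (key k).2.2.2.1.trans (Set.biInter_subset_of_mem (Set.mem_image_of_mem u hlt))
  · simpa only [Set.image_image] using (key i).2.2.2.2

/-- A nonempty compact Hausdorff space of countable tightness has a nonempty closed Gδ subset
contained in the closure of a countable set. -/
theorem exists_nonempty_closed_gdelta_subset_closure_countable
    {X : Type*} [TopologicalSpace X] [CompactSpace X] [T2Space X] [Nonempty X]
    (tight : ∀ (A : Set X) (x : X), x ∈ closure A →
      ∃ B ⊆ A, B.Countable ∧ x ∈ closure B) :
    ∃ S H : Set X, S.Countable ∧ IsClosed H ∧ IsGδ H ∧ H.Nonempty ∧ H ⊆ closure S := by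
  by_contra! h
  obtain ⟨I, _, _, _, hI⟩ := exists_wellOrder_uncountable_countable_Iio
  obtain ⟨x, F, hF, hxF, hanti, hdisj⟩ := exists_points_closed_avoiding_closure h hI
  have : Nonempty I := inferInstance
  obtain ⟨y, hy⟩ : (⋂ i, closure (x '' Set.Ici i)).Nonempty :=
    IsCompact.nonempty_iInter_of_directed_nonempty_isCompact_isClosed _
      (Antitone.directed_ge fun i j hij =>
        closure_mono (Set.image_mono (Set.Ici_subset_Ici.2 hij)))
      (fun i => ⟨x i, subset_closure ⟨i, Set.self_mem_Ici, rfl⟩⟩)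
      (fun _ => isClosed_closure.isCompact) (fun _ => isClosed_closure)
  rw [Set.mem_iInter] at hy
  obtain ⟨B, hB, hBc, hyB⟩ := tight (Set.range x) y
    (closure_mono (Set.image_subset_range _ _) (hy (Classical.arbitrary I)))
  choose! k hk using fun b (hb : b ∈ B) => Set.mem_range.1 (hB hb)
  obtain ⟨i, hi⟩ := (hBc.image k).exists_subset_Iio hI
  refine Set.disjoint_left.1 (hdisj i) ?_ (closure_mono ?_ hyB)
  · refine closure_minimal ?_ (hF i) (hy i)
    rintro _ ⟨j, hj, rfl⟩
    exact hanti hj (hxF j)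
  · exact fun b hb => ⟨k b, hi (Set.mem_image_of_mem k hb), hk b hb⟩

/-- In a compact homogeneous Hausdorff space of countable tightness, every point
lies in a closed Gδ set contained in the closure of a countable set. -/
theorem exists_closed_gdelta_mem_subset_closure_countable
    (X : Type*) [TopologicalSpace X] [CompactSpace X] [T2Space X]
    (homog : ∀ x y : X, ∃ f : X ≃ₜ X, f x = y)
    (tight : ∀ (A : Set X) (x : X), x ∈ closure A →
      ∃ B ⊆ A, B.Countable ∧ x ∈ closure B)
    (p : X) :
    ∃ (S : Set X) (H : Set X), S.Countable ∧ IsClosed H ∧ IsGδ H ∧ p ∈ H ∧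
      H ⊆ closure S := by
  have : Nonempty X := ⟨p⟩
  obtain ⟨S, H, hS, hH, hG, ⟨q, hq⟩, hHS⟩ :=
    exists_nonempty_closed_gdelta_subset_closure_countable tight
  obtain ⟨f, rfl⟩ := homog q p
  refine ⟨f '' S, f '' H, hS.image f, f.isClosed_image.2 hH, ?_, Set.mem_image_of_mem f hq, ?_⟩
  · rw [f.image_eq_preimage_symm]
    exact hG.preimage f.symm.continuous
  · rw [← f.image_closure]
    exact Set.image_mono hHS
end

section
/- Let κ be an uncountable set with the discrete topology and let X be the one-point compactification of κ, with ∞ the point at infinity. Then there do not exist a countable subset S of X and a closed Gδ subset H of X such that ∞ ∈ H and H is contained in the closure of S. (Indeed, the closure of any countable subset of X is countable, while any Gδ subset of X containing ∞ is uncountable.) -/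
open Topology OnePoint

/-- Every set containing the point at infinity of the one-point compactification of a discrete
space is closed. -/
theorem OnePoint.isClosed_of_infty_mem {X : Type*} [TopologicalSpace X] [DiscreteTopology X]
    {s : Set (OnePoint X)} (h : ∞ ∈ s) : IsClosed s :=
  (isClosed_iff_of_mem h).2 (isClosed_discrete _)

/-- In the one-point compactification of a discrete space, countable sets have countable
closure. -/
theorem Set.Countable.closure_onePoint {X : Type*} [TopologicalSpace X] [DiscreteTopology X]
    {s : Set (OnePoint X)} (hs : s.Countable) : (closure s).Countable :=
  (hs.insert ∞).mono <|
    closure_minimal (Set.subset_insert _ _) (isClosed_of_infty_mem (Set.mem_insert _ _))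

/-- In the one-point compactification of a discrete space, a Gδ set containing the point at
infinity has countable complement. -/
theorem IsGδ.countable_compl_of_infty_mem {X : Type*} [TopologicalSpace X] [DiscreteTopology X]
    {s : Set (OnePoint X)} (hs : IsGδ s) (h : ∞ ∈ s) : sᶜ.Countable := by
  obtain ⟨T, hTo, hTc, rfl⟩ := hs
  rw [Set.compl_sInter, Set.sUnion_image]
  refine hTc.biUnion fun t ht => ?_
  have hinf : ∞ ∈ t := Set.mem_sInter.1 h t ht
  have hfin : ((↑) ⁻¹' t : Set X)ᶜ.Finite :=
    ((isOpen_iff_of_mem' hinf).1 (hTo t ht)).1.finite_of_discrete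
  refine (hfin.image ((↑) : X → OnePoint X)).countable.mono fun x hx => ?_
  obtain ⟨y, rfl⟩ := ne_infty_iff_exists.1 (ne_of_mem_of_not_mem hinf hx).symm
  exact Set.mem_image_of_mem _ hx

/-- In the one-point compactification of an uncountable discrete space, the point
at infinity does not lie in any closed Gδ set contained in the closure of a
countable set. -/
theorem onePoint_no_closed_gdelta_at_infty
    (κ : Type*) [TopologicalSpace κ] [DiscreteTopology κ] [Uncountable κ] :
    ¬ ∃ (S : Set (OnePoint κ)) (H : Set (OnePoint κ)), S.Countable ∧
      IsClosed H ∧ IsGδ H ∧ (∞ : OnePoint κ) ∈ H ∧ H ⊆ closure S := by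
  rintro ⟨S, H, hS, -, hG, hinf, hH⟩
  have huniv : (Set.univ : Set (OnePoint κ)).Countable := by
    rw [← Set.union_compl_self H]
    exact (hS.closure_onePoint.mono hH).union (hG.countable_compl_of_infty_mem hinf)
  have : Countable (OnePoint κ) := Set.countable_univ_iff.1 huniv
  exact not_countable (α := κ) coe_injective.countable
end
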